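/- Let f = G·(T_1 + T_2), where G, T_1, T_2 ∈ F[x_1,…,x_n] are products of linear forms, T_1 and T_2 are homogeneous of equal positive degree, T_1 and T_2 have no common linear factor (gcd(T_1,T_2) = 1), and T_1 + T_2 is not a product of linear forms (equivalently, NonLin(f) is nonconstant). Then for each i ∈ {1,2} and every linear form ℓ dividing T_i, there exists a linear form ℓ′ dividing T_{3−i} such that ℓ and ℓ′ are linearly independent and NonLin(f) vanishes on the codimension-2 subspace V(ℓ, ℓ′). -/

import Mathlib

open MvPolynomial

/-- A linear form: a nonzero homogeneous degree-1 polynomial. -/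
def IsLinearForm {F : Type*} [Field F] {n : ℕ} (ℓ : MvPolynomial (Fin n) F) : Prop :=
  ℓ ≠ 0 ∧ ℓ.IsHomogeneous 1

/-- A product of linear forms (a nonzero scalar multiple of a product of linear forms). -/
def IsProdLinearForms {F : Type*} [Field F] {n : ℕ} (g : MvPolynomial (Fin n) F) : Prop :=
  ∃ (c : F) (L : Multiset (MvPolynomial (Fin n) F)),
    c ≠ 0 ∧ (∀ p ∈ L, IsLinearForm p) ∧ g = c • L.prod

/-- `g` has no linear factors. -/
def NoLinearFactor {F : Type*} [Field F] {n : ℕ} (g : MvPolynomial (Fin n) F) : Prop :=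
  ∀ ℓ : MvPolynomial (Fin n) F, IsLinearForm ℓ → ¬ ℓ ∣ g

/-- `h` is the non-linear part `NonLin(f)` of `f` (up to scalars): `h` has no linear
factors and `f` is a product of linear forms times `h`. -/
def IsNonLinPart {F : Type*} [Field F] {n : ℕ} (f h : MvPolynomial (Fin n) F) : Prop :=
  NoLinearFactor h ∧ ∃ L : MvPolynomial (Fin n) F, IsProdLinearForms L ∧ f = L * h

/-- `S(g)`: the set of codimension-2 subspaces `V(ℓ₁,ℓ₂)` of `F^n` on which `g`
vanishes, i.e. `g` belongs to the ideal generated by `ℓ₁, ℓ₂`. -/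
def vanishCodim2 {F : Type*} [Field F] {n : ℕ} (g : MvPolynomial (Fin n) F) :
    Set (Set (Fin n → F)) :=
  {W | ∃ ℓ₁ ℓ₂ : MvPolynomial (Fin n) F, IsLinearForm ℓ₁ ∧ IsLinearForm ℓ₂ ∧
    LinearIndependent F ![ℓ₁, ℓ₂] ∧
    W = {a : Fin n → F | eval a ℓ₁ = 0 ∧ eval a ℓ₂ = 0} ∧
    g ∈ Ideal.span {ℓ₁, ℓ₂}}

section LinearForms

variable {F : Type*} [Field F] {n : ℕ}

theorem IsLinearForm.totalDegree_eq_one {ℓ : MvPolynomial (Fin n) F} (hℓ : IsLinearForm ℓ) :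
    ℓ.totalDegree = 1 :=
  hℓ.2.totalDegree hℓ.1

theorem IsLinearForm.prime {ℓ : MvPolynomial (Fin n) F} (hℓ : IsLinearForm ℓ) : Prime ℓ := by
  refine (irreducible_of_totalDegree_eq_one hℓ.totalDegree_eq_one fun x hx => ?_).prime
  obtain ⟨d, hd⟩ := MvPolynomial.ne_zero_iff.mp hℓ.1
  exact isUnit_iff_ne_zero.mpr fun h0 => hd (zero_dvd_iff.mp (h0 ▸ hx d))

/-- A linear form dividing another one is a scalar multiple of it. -/
theorem IsLinearForm.exists_C_mul_eq_of_dvd {p q : MvPolynomial (Fin n) F}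
    (hp : IsLinearForm p) (hq : IsLinearForm q) (h : p ∣ q) : ∃ c : F, c ≠ 0 ∧ q = C c * p := by
  obtain ⟨u, hu⟩ := (hp.prime.irreducible.associated_of_dvd hq.prime.irreducible h)
  obtain ⟨c, hc, hcu⟩ := isUnit_iff_eq_C_of_isReduced.mp u.isUnit
  exact ⟨c, hc.ne_zero, by rw [← hu, hcu, mul_comm]⟩

theorem IsProdLinearForms.ne_zero {g : MvPolynomial (Fin n) F} (hg : IsProdLinearForms g) :
    g ≠ 0 := by
  obtain ⟨c, L, hc, hL, rfl⟩ := hg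
  exact smul_ne_zero hc (Multiset.prod_ne_zero fun h0 => (hL 0 h0).1 rfl)

theorem IsProdLinearForms.smul {g : MvPolynomial (Fin n) F} (hg : IsProdLinearForms g)
    {a : F} (ha : a ≠ 0) : IsProdLinearForms (a • g) := by
  obtain ⟨c, L, hc, hL, rfl⟩ := hg
  exact ⟨a * c, L, mul_ne_zero ha hc, hL, by rw [mul_smul]⟩

theorem IsProdLinearForms.exists_isHomogeneous {g : MvPolynomial (Fin n) F}
    (hg : IsProdLinearForms g) : ∃ d, g.IsHomogeneous d := by
  obtain ⟨c, L, -, hL, rfl⟩ := hg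
  suffices ∃ d, L.prod.IsHomogeneous d by
    obtain ⟨d, hd⟩ := this
    exact ⟨d, by rw [smul_eq_C_mul]; exact hd.C_mul c⟩
  induction L using Multiset.induction with
  | empty => exact ⟨0, by simpa using isHomogeneous_one (Fin n) F⟩
  | cons p L ih =>
    obtain ⟨d, hd⟩ := ih fun q hq => hL q (Multiset.mem_cons_of_mem hq)
    exact ⟨1 + d, by
      rw [Multiset.prod_cons]; exact (hL p (Multiset.mem_cons_self p L)).2.mul hd⟩

/-- Dividing a product of linear forms by a linear form gives a product of linear forms. -/
theorem IsProdLinearForms.exists_eq_mul_of_dvd {g p : MvPolynomial (Fin n) F}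
    (hg : IsProdLinearForms g) (hp : IsLinearForm p) (h : p ∣ g) :
    ∃ g', IsProdLinearForms g' ∧ g = p * g' := by
  obtain ⟨c, L, hc, hL, rfl⟩ := hg
  rw [smul_eq_C_mul] at h
  have h' : p ∣ L.prod :=
    (hp.prime.dvd_or_dvd h).resolve_left fun hd =>
      hp.prime.not_isUnit (isUnit_of_dvd_unit hd (hc.isUnit.map C))
  obtain ⟨q, hq, hpq⟩ := hp.prime.exists_mem_multiset_dvd h'
  obtain ⟨a, ha, rfl⟩ := hp.exists_C_mul_eq_of_dvd (hL q hq) hpq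
  obtain ⟨L', rfl⟩ := Multiset.exists_cons_of_mem hq
  refine ⟨(c * a) • L'.prod, ⟨c * a, L', mul_ne_zero hc ha,
    fun r hr => hL r (Multiset.mem_cons_of_mem hr), rfl⟩, ?_⟩
  simp only [smul_eq_C_mul, Multiset.prod_cons, C_mul]
  ring

/-- Linear factors can be cancelled against a cofactor that has none of them. -/
theorem IsProdLinearForms.exists_eq_mul_of_mul_eq_mul {G P L h : MvPolynomial (Fin n) F}
    (hG : IsProdLinearForms G) (hL : IsProdLinearForms L) (hh : NoLinearFactor h)
    (heq : G * P = L * h) : ∃ A, IsProdLinearForms A ∧ P = A * h := by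
  obtain ⟨c, K, hc, hK, rfl⟩ := hG
  induction K using Multiset.induction generalizing L with
  | empty =>
    refine ⟨c⁻¹ • L, hL.smul (inv_ne_zero hc), ?_⟩
    rw [smul_mul_assoc, ← heq]
    simp [hc]
  | cons p K ih =>
    have hp := hK p (Multiset.mem_cons_self p K)
    have heq' : p * ((c • K.prod) * P) = L * h := by
      rw [← heq, Multiset.prod_cons]
      simp only [smul_eq_C_mul]
      ring
    obtain ⟨L', hL', rfl⟩ := hL.exists_eq_mul_of_dvd hp
      ((hp.prime.dvd_or_dvd (heq' ▸ dvd_mul_right p _)).resolve_right (hh p hp))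
    exact ih hL' (fun q hq => hK q (Multiset.mem_cons_of_mem hq))
      (mul_left_cancel₀ hp.1 (by rw [heq', mul_assoc]))

/-- A factor with nonzero constant term of a nonzero homogeneous polynomial is constant, provided
the cofactor is homogeneous. -/
theorem MvPolynomial.IsHomogeneous.eq_C_of_mul_of_coeff_zero_ne_zero {A h : MvPolynomial (Fin n) F}
    {d m : ℕ} (hA : A.IsHomogeneous d) (hAh : (A * h).IsHomogeneous m) (hA0 : A ≠ 0)
    (h0 : coeff 0 h ≠ 0) : h = C (coeff 0 h) := by
  obtain ⟨x, hx⟩ := ne_zero_iff.mp hA0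
  have hcoeff : coeff x (A * h) = coeff x A * coeff 0 h := by
    rw [coeff_mul, Finset.sum_eq_single (x, 0)]
    · rintro ⟨a, b⟩ hab hne
      rw [Finset.HasAntidiagonal.mem_antidiagonal] at hab
      by_cases ha : coeff a A = 0
      · simp [ha]
      · have hda := hA.degree_eq_sum_deg_support (mem_support_iff.mpr ha)
        have hdx := hA.degree_eq_sum_deg_support (mem_support_iff.mpr hx)
        have hb : b = 0 := by
          rw [← Finsupp.degree_eq_zero_iff]
          have := congrArg Finsupp.degree hab
          rw [map_add] at this
          dsimp only at this
          simp only [← Finsupp.degree_apply] at hda hdx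
          omega
        subst hb
        exact absurd (by simpa using hab) hne
    · simp
  have hdm : d = m := by
    by_contra hne
    refine mul_ne_zero hx h0 (hcoeff ▸ hAh.coeff_eq_zero fun hdeg => hne ?_)
    rw [← hdeg]
    by_contra hne'
    exact hx (hA.coeff_eq_zero (Ne.symm hne'))
  have hne : h ≠ 0 := by rintro rfl; simp at h0
  have htd := totalDegree_mul_of_isDomain hA0 hne
  rw [hAh.totalDegree (mul_ne_zero hA0 hne), hA.totalDegree hA0, hdm] at htd
  exact totalDegree_eq_zero_iff_eq_C.mp (by omega)

/-- A linear form `ℓ` generates the kernel of a linear substitution of variables. -/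
theorem IsLinearForm.exists_retraction {ℓ : MvPolynomial (Fin n) F} (hℓ : IsLinearForm ℓ) :
    ∃ φ : MvPolynomial (Fin n) F →ₐ[F] MvPolynomial (Fin n) F,
      φ ℓ = 0 ∧ (∀ g, ℓ ∣ g - φ g) ∧ ∀ p, p.IsHomogeneous 1 → (φ p).IsHomogeneous 1 := by
  obtain ⟨d, hd⟩ := MvPolynomial.ne_zero_iff.mp hℓ.1
  have hdeg : d.degree = 1 := by
    by_contra hne
    exact hd (hℓ.2.coeff_eq_zero hne)
  obtain ⟨i, rfl⟩ := (Finsupp.sum_eq_one_iff d).mp hdeg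
  set a := coeff (Finsupp.single i 1) ℓ
  set v : MvPolynomial (Fin n) F → MvPolynomial (Fin n) F :=
    fun p => C (a⁻¹ * coeff (Finsupp.single i 1) p) * ℓ
  have hlin : ∀ p : MvPolynomial (Fin n) F, p.IsHomogeneous 1 →
      aeval (fun j => X j - v (X j)) p = p - v p := by
    intro p hp
    rw [← mem_homogeneousSubmodule, homogeneousSubmodule_one_eq_span_X] at hp
    induction hp using Submodule.span_induction with
    | mem p hp => obtain ⟨j, rfl⟩ := hp; rw [aeval_X]
    | zero => simp [v]
    | add p q _ _ hp hq =>
      rw [map_add, hp, hq]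
      simp only [v, coeff_add, mul_add, C_add]
      ring
    | smul c p _ hp =>
      rw [map_smul, hp]
      simp only [v, smul_eq_C_mul, coeff_C_mul, C_mul]
      ring
  refine ⟨aeval fun j => X j - v (X j), ?_, fun g => ?_, fun p hp => ?_⟩
  · rw [hlin ℓ hℓ.2]
    simp only [v]
    rw [inv_mul_cancel₀ hd, C_1, one_mul, sub_self]
  · induction g using MvPolynomial.induction_on with
    | C c => simp
    | add p q hp hq =>
      rw [map_add, add_sub_add_comm]
      exact dvd_add hp hq
    | mul_X p j hp =>
      rw [map_mul, aeval_X]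
      obtain ⟨r, hr⟩ := hp
      refine ⟨r * X j + aeval (fun j => X j - v (X j)) p *
        C (a⁻¹ * coeff (Finsupp.single i 1) (X j)), ?_⟩
      simp only [v] at hr ⊢
      linear_combination X j * hr
  · rw [hlin p hp]
    exact hp.sub (hℓ.2.C_mul _)

/-- If the linear form `ℓ` divides `T₁` but not `T₂`, a factor `h` of `T₁ + T₂`
with zero constant term vanishes on `V(ℓ, ℓ')` for some linear factor `ℓ'` of `T₂`. -/
theorem exists_linearForm_mem_span {A T₁ T₂ h ℓ : MvPolynomial (Fin n) F}
    (hT₂ : IsProdLinearForms T₂) (hsum : T₁ + T₂ = A * h) (h0 : coeff 0 h = 0)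
    (hℓ : IsLinearForm ℓ) (hℓT₁ : ℓ ∣ T₁) (hℓT₂ : ¬ ℓ ∣ T₂) :
    ∃ ℓ', IsLinearForm ℓ' ∧ ℓ' ∣ T₂ ∧ LinearIndependent F ![ℓ, ℓ'] ∧ h ∈ Ideal.span {ℓ, ℓ'} := by
  obtain ⟨φ, hφℓ, hφ, hφhom⟩ := hℓ.exists_retraction
  have hφ0 : ∀ g, φ g = 0 → ℓ ∣ g := fun g hg => by simpa [hg] using hφ g
  obtain ⟨c, L, hc, hL, rfl⟩ := hT₂
  have hdvd : ∀ p ∈ L, p ∣ c • L.prod := fun p hp =>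
    (Multiset.dvd_prod hp).trans (by rw [smul_eq_C_mul]; exact dvd_mul_left _ _)
  have hform : ∀ p ∈ L, IsLinearForm (φ p) := fun p hp =>
    ⟨fun hz => hℓT₂ ((hφ0 p hz).trans (hdvd p hp)), hφhom p (hL p hp).2⟩
  obtain ⟨t, rfl⟩ := hℓT₁
  have hprod : c • (L.map φ).prod = φ A * φ h := by
    rw [← map_mul, ← hsum, map_add, map_mul, hφℓ, zero_mul, zero_add, map_smul, map_multiset_prod]
  have hnu : ¬ IsUnit (φ h) := by
    intro hu
    obtain ⟨s, hs⟩ := hφ h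
    have h1 : constantCoeff ℓ = 0 := hℓ.2.coeff_eq_zero (by simp)
    have h2 : constantCoeff (φ h) = 0 := by
      have := congrArg constantCoeff hs
      rw [map_sub, map_mul, h1, zero_mul] at this
      simpa [constantCoeff_eq, h0] using this
    exact (hu.map constantCoeff).ne_zero h2
  obtain ⟨p, hp, q, hq⟩ : ∃ p ∈ L, φ p ∣ φ h := by
    have hne : φ h ≠ 0 := fun hz => by
      rw [hz, mul_zero] at hprod
      exact IsProdLinearForms.ne_zero ⟨c, L.map φ, hc, by simpa using hform, rfl⟩ hprod
    obtain ⟨r, hr, hrh⟩ := WfDvdMonoid.exists_irreducible_factor hnu hne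
    have hrL : r ∣ (L.map φ).prod := by
      have h3 : r ∣ C c * (L.map φ).prod := by
        rw [← smul_eq_C_mul, hprod]; exact hrh.mul_left _
      exact (hr.prime.dvd_or_dvd h3).resolve_left fun hd =>
        hr.not_isUnit (isUnit_of_dvd_unit hd (hc.isUnit.map C))
    obtain ⟨s, hs, hrs⟩ := hr.prime.exists_mem_multiset_dvd hrL
    obtain ⟨p, hp, rfl⟩ := Multiset.mem_map.mp hs
    exact ⟨p, hp, ((hr.associated_of_dvd (hform p hp).prime.irreducible hrs).dvd_iff_dvd_left).mp
      hrh⟩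
  refine ⟨p, hL p hp, hdvd p hp, ?_, ?_⟩
  · rw [LinearIndependent.pair_iff' hℓ.1]
    intro a ha
    exact (hform p hp).1 (by rw [← ha, map_smul, hφℓ, smul_zero])
  · obtain ⟨s, hs⟩ := hφ h
    obtain ⟨r, hr⟩ := hφ p
    rw [Ideal.mem_span_pair]
    exact ⟨s - r * q, q, by linear_combination -hs - hq + q * hr⟩

end LinearForms

/-- For every linear factor `ℓ` of one gate `Tᵢ` there is a linear factor `ℓ'` of the
other gate, linearly independent from `ℓ`, such that `NonLin(f)` vanishes on `V(ℓ,ℓ')`. -/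
theorem nonlin_vanishes_on_codim2_from_gate_factor
    {F : Type*} [Field F] [Fintype F] {n m : ℕ}
    (G T₁ T₂ f h : MvPolynomial (Fin n) F)
    (hm : 0 < m)
    (hG : IsProdLinearForms G) (hT₁ : IsProdLinearForms T₁) (hT₂ : IsProdLinearForms T₂)
    (hT₁hom : T₁.IsHomogeneous m) (hT₂hom : T₂.IsHomogeneous m)
    (hgcd : ∀ ℓ : MvPolynomial (Fin n) F, IsLinearForm ℓ → ℓ ∣ T₁ → ¬ ℓ ∣ T₂)
    (hnl : ¬ IsProdLinearForms (T₁ + T₂))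
    (hf : f = G * (T₁ + T₂)) (hh : IsNonLinPart f h) :
    ∀ ℓ : MvPolynomial (Fin n) F, IsLinearForm ℓ →
      (ℓ ∣ T₁ → ∃ ℓ' : MvPolynomial (Fin n) F, IsLinearForm ℓ' ∧ ℓ' ∣ T₂ ∧
        LinearIndependent F ![ℓ, ℓ'] ∧ h ∈ Ideal.span {ℓ, ℓ'}) ∧
      (ℓ ∣ T₂ → ∃ ℓ' : MvPolynomial (Fin n) F, IsLinearForm ℓ' ∧ ℓ' ∣ T₁ ∧
        LinearIndependent F ![ℓ, ℓ'] ∧ h ∈ Ideal.span {ℓ, ℓ'}) := by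
  obtain ⟨hnlf, L, hL, hfL⟩ := hh
  obtain ⟨A, hA, hAh⟩ := hG.exists_eq_mul_of_mul_eq_mul hL hnlf (hf.symm.trans hfL)
  have h0 : coeff 0 h = 0 := by
    by_contra hne
    obtain ⟨d, hd⟩ := hA.exists_isHomogeneous
    have hC := hd.eq_C_of_mul_of_coeff_zero_ne_zero (hAh ▸ hT₁hom.add hT₂hom) hA.ne_zero hne
    apply hnl
    rw [hAh, hC, mul_comm, ← smul_eq_C_mul]
    exact hA.smul hne
  exact fun ℓ hℓ =>
    ⟨fun h₁ => exists_linearForm_mem_span hT₂ hAh h0 hℓ h₁ (hgcd ℓ hℓ h₁),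
      fun h₂ => exists_linearForm_mem_span hT₁ ((add_comm _ _).trans hAh) h0 hℓ h₂
        fun h₁ => hgcd ℓ hℓ h₁ h₂⟩
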